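/- arXiv:1108.1035 — 3 statements merged into one kernel-verified Lean document; each statement's English description precedes it below -/
import Mathlib

section
/- Let ω > 0 and let 0 < v⁺ < 1 < v⁻. Define c = (ω/2)(1-v⁺)²/(v⁻ - v⁺) and K₀ = -c v⁻. Then c > 0, K₀ + c < 0, and the numbers z⁺ := A(v⁺) = v⁺/2 and z⁻ := A(v⁻) = 1 - 1/(2v⁻) satisfy 0 < z⁺ < 1/2 < z⁻ < 1, F(z⁺) = F(z⁻) = 0, F′(z⁺) < 0, F′(z⁻) > 0, and F(z) < 0 for all z with z⁺ < z < z⁻. -/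
/-- The function `A` of the simple model. -/
noncomputable def Asimple (φ : ℝ) : ℝ := if φ ≤ 1 then φ / 2 else 1 - 1 / (2 * φ)

/-- The function `F` of the simple model. -/
noncomputable def Fsimple (ω c K₀ z : ℝ) : ℝ :=
  if z < 1 / 2 then K₀ + 2 * c * z + ω / 2 * (1 - 2 * z) ^ 2 else K₀ + c / (2 * (1 - z))

theorem hasDerivAt_Fsimple_of_lt (ω c K₀ : ℝ) {z : ℝ} (hz : z < 1 / 2) :
    HasDerivAt (Fsimple ω c K₀) (2 * c - 2 * ω * (1 - 2 * z)) z := by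
  have h : HasDerivAt (fun x : ℝ => K₀ + 2 * c * x + ω / 2 * (1 - 2 * x) ^ 2)
      (2 * c - 2 * ω * (1 - 2 * z)) z := by
    have hx := hasDerivAt_id' z
    refine (((hx.const_mul (2 * c)).const_add K₀).fun_add
      ((((hx.const_mul 2).const_sub 1).fun_pow 2).const_mul (ω / 2))).congr_deriv ?_
    norm_num
    ring
  refine h.congr_of_eventuallyEq ?_
  filter_upwards [Iio_mem_nhds hz] with x hx
  exact if_pos hx

theorem hasDerivAt_Fsimple_of_gt (ω c K₀ : ℝ) {z : ℝ} (hz : 1 / 2 < z) (hz1 : z < 1) :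
    HasDerivAt (Fsimple ω c K₀) (c / (2 * (1 - z) ^ 2)) z := by
  have hne : 1 - z ≠ 0 := by linarith
  have h : HasDerivAt (fun x : ℝ => K₀ + c / (2 * (1 - x))) (c / (2 * (1 - z) ^ 2)) z := by
    have hx := ((hasDerivAt_id' z).const_sub 1).const_mul 2
    refine (((hasDerivAt_const z c).fun_div hx (by simpa using hne)).const_add K₀).congr_deriv ?_
    field_simp
    ring
  refine h.congr_of_eventuallyEq ?_
  filter_upwards [Ioi_mem_nhds hz] with x hx
  exact if_neg (not_lt.mpr (Set.mem_Ioi.mp hx).le)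

/-- Let `ω > 0` and `0 < v⁺ < 1 < v⁻`.  Define `c = (ω/2)(1-v⁺)²/(v⁻-v⁺)` and
`K₀ = -c v⁻`.  Then `c > 0`, `K₀ + c < 0`, and `z⁺ := A(v⁺) = v⁺/2`,
`z⁻ := A(v⁻) = 1 - 1/(2v⁻)` satisfy `0 < z⁺ < 1/2 < z⁻ < 1`,
`F(z⁺) = F(z⁻) = 0`, `F′(z⁺) < 0`, `F′(z⁻) > 0`, and `F(z) < 0` for
`z⁺ < z < z⁻`. -/
theorem stmt_4 (ω vp vm : ℝ) (hω : 0 < ω) (h0 : 0 < vp) (h1 : vp < 1) (h2 : 1 < vm) :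
    let c : ℝ := ω / 2 * (1 - vp) ^ 2 / (vm - vp)
    let K₀ : ℝ := -c * vm
    let zp : ℝ := vp / 2
    let zm : ℝ := 1 - 1 / (2 * vm)
    0 < c ∧ K₀ + c < 0 ∧
    Asimple vp = zp ∧ Asimple vm = zm ∧
    0 < zp ∧ zp < 1 / 2 ∧ 1 / 2 < zm ∧ zm < 1 ∧
    Fsimple ω c K₀ zp = 0 ∧ Fsimple ω c K₀ zm = 0 ∧
    deriv (Fsimple ω c K₀) zp < 0 ∧ 0 < deriv (Fsimple ω c K₀) zm ∧
    (∀ z : ℝ, zp < z → z < zm → Fsimple ω c K₀ z < 0) := by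
  intro c K₀ zp zm
  have hd : 0 < vm - vp := by linarith
  have hvm : 0 < vm := by linarith
  have hvp : 0 < 1 - vp := by linarith
  have hc : 0 < c := by positivity
  have hcd : c * (vm - vp) = ω / 2 * (1 - vp) ^ 2 := div_mul_cancel₀ _ hd.ne'
  have hlt : c < ω / 2 * (1 - vp) := by
    rw [div_lt_iff₀ hd]
    nlinarith [mul_pos (mul_pos hω hvp) (sub_pos.mpr h2)]
  have hK : K₀ = -c * vm := rfl
  have hzp : zp = vp / 2 := rfl
  have hzm : 1 - zm = 1 / (2 * vm) := sub_sub_cancel _ _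
  have hinv : 0 < 1 / (2 * vm) := by positivity
  have hinv' : 1 / (2 * vm) < 1 / 2 := one_div_lt_one_div_of_lt two_pos (by linarith)
  have hzp2 : zp < 1 / 2 := by linarith
  have hzm2 : 1 / 2 < zm := by linarith
  have hzm1 : zm < 1 := by linarith
  clear_value c K₀ zp
  refine ⟨hc, by nlinarith, by rw [Asimple, if_pos h1.le, hzp], if_neg (not_le.mpr h2),
    by linarith, hzp2, hzm2, hzm1, ?_, ?_, ?_, ?_, ?_⟩
  · rw [Fsimple, if_pos hzp2, hK, hzp]
    linear_combination -hcd
  · rw [Fsimple, if_neg (not_lt.mpr hzm2.le), hzm, hK]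
    field_simp
    ring
  · rw [(hasDerivAt_Fsimple_of_lt ω c K₀ hzp2).deriv, hzp]
    nlinarith
  · rw [(hasDerivAt_Fsimple_of_gt ω c K₀ hzm2 hzm1).deriv, hzm]
    positivity
  · intro z hz hz'
    rw [Fsimple, hK]
    split_ifs with h
    · have hx : 0 < 2 * z - vp := by linarith
      have hy : 0 < ω / 2 * (2 - 2 * z - vp) - c := by
        nlinarith [mul_pos hω (sub_pos.mpr h)]
      linarith [mul_pos hx hy]
    · have hz1 : 1 / (2 * vm) < 1 - z := by linarith
      have hpos : 0 < 1 - z := by linarith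
      have hv : 1 < (1 - z) * (2 * vm) := (div_lt_iff₀ (by positivity)).mp hz1
      have : c / (2 * (1 - z)) < c * vm := by
        rw [div_lt_iff₀ (by positivity)]
        nlinarith
      linarith
end

section
/- Let ω > 0 and let V : ℝ × [0,T] → ℝ be a smooth function with ∂ₓV(x,t) > 0 and ∂ₓₓV(x,t) - ∂ₓV(x,t) < 0 for all x ∈ ℝ, t ∈ [0,T], satisfying the fully nonlinear equation ∂ₜV - (ω²/2)(∂ₓV)²/(∂ₓₓV - ∂ₓV) = 0. Then the transformed function φ̃(x,t) := -(1/ω)(∂ₓₓV(x,t) - ∂ₓV(x,t))/∂ₓV(x,t), which is positive, satisfies the equation ∂ₜφ̃ + (1/2) ∂ₓ( φ̃⁻² ∂ₓφ̃ ) - ∂ₓ( 1/(2φ̃) ) = 0 at every point (x,t). -/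
/-- Partial derivative in the first variable as a full derivative. -/
lemma hasDerivAt_slice_fst {F : ℝ × ℝ → ℝ} (hF : ContDiff ℝ (⊤ : ℕ∞) F) (x t : ℝ) :
    HasDerivAt (fun y => F (y, t)) (fderiv ℝ F (x, t) (1, 0)) x :=
  ((hF.differentiable (by simp)).differentiableAt.hasFDerivAt).comp_hasDerivAt x
    ((hasDerivAt_id x).prodMk (hasDerivAt_const x t))

/-- Partial derivative in the second variable as a full derivative. -/
lemma hasDerivAt_slice_snd {F : ℝ × ℝ → ℝ} (hF : ContDiff ℝ (⊤ : ℕ∞) F) (x t : ℝ) :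
    HasDerivAt (fun s => F (x, s)) (fderiv ℝ F (x, t) (0, 1)) t :=
  ((hF.differentiable (by simp)).differentiableAt.hasFDerivAt).comp_hasDerivAt t
    ((hasDerivAt_const t x).prodMk (hasDerivAt_id t))

lemma contDiff_fderiv_apply_const {F : ℝ × ℝ → ℝ} (hF : ContDiff ℝ (⊤ : ℕ∞) F) (v : ℝ × ℝ) :
    ContDiff ℝ (⊤ : ℕ∞) (fun p => fderiv ℝ F p v) :=
  (hF.fderiv_right (m := ((⊤ : ℕ∞) : WithTop ℕ∞)) (by simp)).clm_apply contDiff_const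

lemma fderiv_fderiv_apply_comm {F : ℝ × ℝ → ℝ} (hF : ContDiff ℝ (⊤ : ℕ∞) F) (p v w : ℝ × ℝ) :
    fderiv ℝ (fun q => fderiv ℝ F q v) p w = fderiv ℝ (fun q => fderiv ℝ F q w) p v := by
  have hd : DifferentiableAt ℝ (fderiv ℝ F) p :=
    ((hF.fderiv_right (m := ((⊤ : ℕ∞) : WithTop ℕ∞)) (by simp)).differentiable (by simp)).differentiableAt
  have hs : IsSymmSndFDerivAt ℝ F p :=
    hF.contDiffAt.isSymmSndFDerivAt (by
      rw [minSmoothness_of_isRCLikeNormedField]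
      exact WithTop.coe_le_coe.2 (le_top (a := (2 : ℕ∞))))
  rw [fderiv_clm_apply hd (differentiableAt_const v),
    fderiv_clm_apply hd (differentiableAt_const w)]
  simpa using hs w v

/-- If `a' = a (1 - ω f)` and `c = -(ω / 2) a / f`, then `(c' / a)'`, cleared of denominators, is
an expression in `f` alone. -/
lemma deriv_deriv_mul_sub_of_riccati {ω : ℝ} {a c f : ℝ → ℝ}
    (ha : Differentiable ℝ a) (hf : ContDiff ℝ (⊤ : ℕ∞) f) (hf0 : ∀ y, f y ≠ 0)
    (hda : ∀ y, deriv a y = a y * (1 - ω * f y))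
    (hc : ∀ y, c y = -(ω / 2) * (a y / f y)) (x : ℝ) :
    deriv (deriv c) x * a x - deriv a x * deriv c x
      = -(ω / 2) * a x ^ 2 * (2 * deriv (fun y => 1 / (2 * f y)) x
          - deriv (fun y => (f y ^ 2)⁻¹ * deriv f y) x) := by
  have hfd : Differentiable ℝ f := hf.differentiable (by simp)
  have hf' : Differentiable ℝ (deriv f) :=
    ((contDiff_infty_iff_deriv.1 hf).2).differentiable (by simp)
  have hh : Differentiable ℝ (fun y => 1 / (2 * f y)) := fun y =>
    (differentiableAt_const _).div ((hfd y).const_mul 2) (mul_ne_zero two_ne_zero (hf0 y))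
  have hg : Differentiable ℝ (fun y => (f y ^ 2)⁻¹ * deriv f y) := fun y =>
    (((hfd y).pow 2).inv (pow_ne_zero 2 (hf0 y))).mul (hf' y)
  have hc' : deriv c = fun y => -(ω / 2) *
      (a y * (2 * (1 / (2 * f y)) - ω - (f y ^ 2)⁻¹ * deriv f y)) := by
    funext y
    have h := (((ha y).hasDerivAt.div (hfd y).hasDerivAt (hf0 y)).const_mul (-(ω / 2))).deriv
    rw [show c = fun y => -(ω / 2) * (a / f) y from funext hc, h, hda]
    have := hf0 y
    field_simp
  have hc'' := (((ha x).hasDerivAt.mul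
    ((((hh x).hasDerivAt.const_mul 2).sub_const ω).sub (hg x).hasDerivAt)).const_mul
      (-(ω / 2))).deriv
  have hc2 : deriv (deriv c) x = _ := (congrArg (fun k => deriv k x) hc').trans hc''
  rw [hc2, hc']
  simp only [Pi.sub_apply]
  ring


/-- Let `ω > 0` and let `V` be a smooth function with `∂ₓV > 0` and
`∂ₓₓV - ∂ₓV < 0` on `ℝ × [0,T]`, satisfying
`∂ₜV - (ω²/2)(∂ₓV)²/(∂ₓₓV - ∂ₓV) = 0`.  Then
`φ̃ := -(1/ω)(∂ₓₓV - ∂ₓV)/∂ₓV` is positive and satisfies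
`∂ₜφ̃ + (1/2)∂ₓ(φ̃⁻² ∂ₓφ̃) - ∂ₓ(1/(2φ̃)) = 0` at every point `(x,t)`. -/
theorem stmt_7 (ω T : ℝ) (hω : 0 < ω) (V φ : ℝ → ℝ → ℝ)
    (hsmooth : ContDiff ℝ (⊤ : ℕ∞) (fun p : ℝ × ℝ => V p.1 p.2))
    (hVx : ∀ x t, t ∈ Set.Icc 0 T → 0 < deriv (fun y => V y t) x)
    (hVxxVx : ∀ x t, t ∈ Set.Icc 0 T →
      deriv (deriv (fun y => V y t)) x - deriv (fun y => V y t) x < 0)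
    (hPDE : ∀ x t, t ∈ Set.Icc 0 T →
      deriv (fun s => V x s) t
        - ω ^ 2 / 2 * (deriv (fun y => V y t) x) ^ 2
            / (deriv (deriv (fun y => V y t)) x - deriv (fun y => V y t) x) = 0)
    (hφ : ∀ x t, φ x t
        = -(1 / ω) * ((deriv (deriv (fun y => V y t)) x - deriv (fun y => V y t) x)
            / deriv (fun y => V y t) x)) :
    ∀ x t, t ∈ Set.Icc 0 T →
      0 < φ x t ∧
      deriv (fun s => φ x s) t
        + 1 / 2 * deriv (fun y => ((φ y t) ^ 2)⁻¹ * deriv (fun y' => φ y' t) y) x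
        - deriv (fun y => 1 / (2 * φ y t)) x = 0 := by
  intro x t ht
  let F : ℝ × ℝ → ℝ := fun p => V p.1 p.2
  have hF : ContDiff ℝ (⊤ : ℕ∞) F := hsmooth
  let A : ℝ × ℝ → ℝ := fun p => fderiv ℝ F p (1, 0)
  have hA : ContDiff ℝ (⊤ : ℕ∞) A := contDiff_fderiv_apply_const hF _
  let B : ℝ × ℝ → ℝ := fun p => fderiv ℝ A p (1, 0)
  have hB : ContDiff ℝ (⊤ : ℕ∞) B := contDiff_fderiv_apply_const hA _
  let C : ℝ × ℝ → ℝ := fun p => fderiv ℝ F p (0, 1)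
  have hC : ContDiff ℝ (⊤ : ℕ∞) C := contDiff_fderiv_apply_const hF _
  let E : ℝ × ℝ → ℝ := fun p => fderiv ℝ C p (1, 0)
  have hE : ContDiff ℝ (⊤ : ℕ∞) E := contDiff_fderiv_apply_const hC _
  have dA : ∀ s, deriv (fun y => V y s) = fun y => A (y, s) := fun s =>
    funext fun y => (hasDerivAt_slice_fst hF y s).deriv
  have dB : ∀ s, deriv (fun y => A (y, s)) = fun y => B (y, s) := fun s =>
    funext fun y => (hasDerivAt_slice_fst hA y s).deriv
  have dC : ∀ y s, deriv (fun s => V y s) s = C (y, s) := fun y s =>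
    (hasDerivAt_slice_snd hF y s).deriv
  have dE : deriv (fun y => C (y, t)) = fun y => E (y, t) :=
    funext fun y => (hasDerivAt_slice_fst hC y t).deriv
  have hAE : ∀ p, fderiv ℝ A p (0, 1) = E p := fun p => fderiv_fderiv_apply_comm hF p _ _
  have hBE : fderiv ℝ B (x, t) (0, 1) = deriv (fun y => E (y, t)) x := by
    rw [(hasDerivAt_slice_fst hE x t).deriv, ← funext hAE]
    exact fderiv_fderiv_apply_comm hA _ _ _
  simp only [dA, dB, dC] at hVx hVxxVx hPDE hφ
  have hApos : ∀ y, 0 < A (y, t) := fun y => hVx y t ht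
  have hneg : ∀ y, B (y, t) - A (y, t) < 0 := fun y => hVxxVx y t ht
  have hpos : ∀ y, 0 < φ y t := fun y => by
    rw [hφ, neg_mul, ← mul_neg, ← neg_div]
    exact mul_pos (one_div_pos.2 hω) (div_pos (neg_pos.2 (hneg y)) (hApos y))
  refine ⟨hpos x, ?_⟩
  have hslice : ∀ {G : ℝ × ℝ → ℝ}, ContDiff ℝ (⊤ : ℕ∞) G → ContDiff ℝ (⊤ : ℕ∞) (fun y => G (y, t)) :=
    fun hG => hG.comp (contDiff_id.prodMk contDiff_const)
  have hf : ContDiff ℝ (⊤ : ℕ∞) (fun y => φ y t) := by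
    simp only [hφ]
    exact contDiff_const.mul
      (((hslice hB).sub (hslice hA)).div (hslice hA) fun y => (hApos y).ne')
  have key := deriv_deriv_mul_sub_of_riccati (ω := ω) (a := fun y => A (y, t))
    (c := fun y => C (y, t)) ((hslice hA).differentiable (by simp)) hf
    (fun y => (hpos y).ne')
    (fun y => by
      have := (hApos y).ne'
      rw [dB, hφ]
      field_simp
      ring)
    (fun y => by
      have h1 := (hApos y).ne'
      have h2 := (hneg y).ne
      rw [sub_eq_zero.1 (hPDE y t ht), hφ]
      field_simp) x
  have hAt := hasDerivAt_slice_snd hA x t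
  have hBt := hasDerivAt_slice_snd hB x t
  rw [hAE] at hAt
  rw [hBE] at hBt
  have hφt : deriv (fun s => φ x s) t = _ :=
    (congrArg (fun k => deriv k t) (funext (hφ x))).trans
      (((hBt.sub hAt).div hAt (hApos x).ne').const_mul (-(1 / ω))).deriv
  rw [dB, dE] at key
  have hA0 := (hApos x).ne'
  rw [hφt]
  simp only [Pi.sub_apply]
  generalize deriv (fun y => E (y, t)) x = e at *
  generalize deriv (fun y => 1 / (2 * φ y t)) x = h' at *
  generalize deriv (fun y => ((φ y t) ^ 2)⁻¹ * deriv (fun y' => φ y' t) y) x = g' at *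
  have hnum : (e - E (x, t)) * A (x, t) - (B (x, t) - A (x, t)) * E (x, t)
      = -(ω / 2) * A (x, t) ^ 2 * (2 * h' - g') := by
    linear_combination key
  rw [hnum]
  field_simp
  ring
end

section
/- Let ω > 0 and 0 < ṽ⁺ < 1 < ṽ⁻ be prescribed. Define B̃ := A + B, c̃ := (B̃(ṽ⁻) - B̃(ṽ⁺))/(ṽ⁻ - ṽ⁺) and K₀ := -c̃ ṽ⁻ + B̃(ṽ⁻). Assume that the function G̃(v) := K₀ + c̃ v - B̃(v) satisfies G̃(v) < 0 for all v with ṽ⁺ < v < ṽ⁻, G̃′(ṽ⁺) < 0 and G̃′(ṽ⁻) > 0. Then there exists a continuously differentiable, strictly decreasing function ṽ : ℝ → (0,∞) with ṽ⁺ < ṽ(ξ) < ṽ⁻ for all ξ, lim_{ξ→-∞} ṽ(ξ) = ṽ⁻, lim_{ξ→+∞} ṽ(ξ) = ṽ⁺, and d/dξ [A(ṽ(ξ))] = K₀ + c̃ ṽ(ξ) - B̃(ṽ(ξ)) for all ξ ∈ ℝ; hence φ̃(x,t) := ṽ(x + c̃(T-t)) is a traveling wave solution with positive wave speed c̃ of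 ∂ₜφ̃ + ∂ₓₓ A(φ̃) + ∂ₓ B̃(φ̃) = 0. -/
/-- The function `B` of the simple model. -/
noncomputable def Bsimple (ω φ : ℝ) : ℝ := if φ ≤ 1 then -(ω / 2) * (1 - φ) ^ 2 else 0

/-- The flux function `B̃ = A + B` of the quadratic drift model. -/
noncomputable def Btilde (ω φ : ℝ) : ℝ := Asimple φ + Bsimple ω φ

/-- The traveling wave speed `c̃` determined by the limiting values `ṽ⁺ < ṽ⁻`. -/
noncomputable def ctilde (ω vp vm : ℝ) : ℝ := (Btilde ω vm - Btilde ω vp) / (vm - vp)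

/-- The intercept `K₀ = -c̃ ṽ⁻ + B̃(ṽ⁻)`. -/
noncomputable def K0tilde (ω vp vm : ℝ) : ℝ := -ctilde ω vp vm * vm + Btilde ω vm

/-- `G̃(v) = K₀ + c̃ v - B̃(v)`. -/
noncomputable def Gtilde (ω vp vm v : ℝ) : ℝ :=
  K0tilde ω vp vm + ctilde ω vp vm * v - Btilde ω v

lemma hasDerivAt_ite_le {f g d : ℝ → ℝ} {c : ℝ} (hf : ∀ x ≤ c, HasDerivAt f (d x) x)
    (hg : ∀ x, c ≤ x → HasDerivAt g (d x) x) (hfg : f c = g c) (x : ℝ) :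
    HasDerivAt (fun y => if y ≤ c then f y else g y) (d x) x := by
  rcases lt_trichotomy x c with h | rfl | h
  · refine (hf x h.le).congr_of_eventuallyEq ?_
    filter_upwards [Iio_mem_nhds h] with y hy
    exact if_pos (le_of_lt hy)
  · rw [← hasDerivWithinAt_univ, ← Set.Iic_union_Ici (a := x)]
    refine HasDerivWithinAt.union ?_ ?_
    · refine (hf x le_rfl).hasDerivWithinAt.congr (fun y hy => if_pos hy) (if_pos le_rfl)
    · refine (hg x le_rfl).hasDerivWithinAt.congr (fun y hy => ?_) (by simp [hfg])
      rcases eq_or_lt_of_le (Set.mem_Ici.1 hy) with rfl | h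
      · simp [hfg]
      · exact if_neg (not_le.2 h)
  · refine (hg x h.le).congr_of_eventuallyEq ?_
    filter_upwards [Ioi_mem_nhds h] with y hy
    exact if_neg (not_le.2 hy)

lemma hasDerivAt_Asimple (x : ℝ) : HasDerivAt Asimple (1 / (2 * max 1 x ^ 2)) x := by
  refine hasDerivAt_ite_le (c := 1) (f := fun φ => φ / 2) (g := fun φ => 1 - 1 / (2 * φ))
    (d := fun x => 1 / (2 * max 1 x ^ 2)) (fun x hx => ?_) (fun x hx => ?_) (by norm_num) x
  · simpa [max_eq_left hx] using (hasDerivAt_id x).div_const 2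
  · have hx0 : x ≠ 0 := by linarith
    have h := (((hasDerivAt_id x).const_mul 2).inv (by simpa using hx0)).const_sub 1
    simp only [max_eq_right hx, one_div]
    refine h.congr_deriv ?_
    simp only [id]
    field_simp

lemma hasDerivAt_Bsimple (ω x : ℝ) : HasDerivAt (Bsimple ω) (ω * max 0 (1 - x)) x := by
  refine hasDerivAt_ite_le (c := 1) (f := fun φ => -(ω / 2) * (1 - φ) ^ 2) (g := fun _ => 0)
    (d := fun x => ω * max 0 (1 - x)) (fun x hx => ?_) (fun x hx => ?_) (by norm_num) x
  · have h := (((hasDerivAt_id x).const_sub 1).pow 2).const_mul (-(ω / 2))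
    simp only [max_eq_right (sub_nonneg.2 hx)]
    refine h.congr_deriv ?_
    simp only [id]
    ring
  · simpa [max_eq_left (sub_nonpos.2 hx)] using hasDerivAt_const x (0 : ℝ)

lemma hasDerivAt_Btilde (ω x : ℝ) :
    HasDerivAt (Btilde ω) (1 / (2 * max 1 x ^ 2) + ω * max 0 (1 - x)) x :=
  (hasDerivAt_Asimple x).add (hasDerivAt_Bsimple ω x)

lemma hasDerivAt_Gtilde (ω vp vm x : ℝ) :
    HasDerivAt (Gtilde ω vp vm)
      (ctilde ω vp vm - (1 / (2 * max 1 x ^ 2) + ω * max 0 (1 - x))) x := by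
  refine HasDerivAt.sub ?_ (hasDerivAt_Btilde ω x)
  simpa using ((hasDerivAt_id x).const_mul (ctilde ω vp vm)).const_add (K0tilde ω vp vm)

lemma ctilde_pos {ω vp vm : ℝ} (hω : 0 < ω) (h1 : vp < 1) (h2 : 1 < vm) :
    0 < ctilde ω vp vm := by
  refine div_pos ?_ (by linarith)
  have h3 : 1 / (2 * vm) < 1 / 2 := by
    rw [div_lt_div_iff₀] <;> linarith
  have h4 : 0 ≤ ω / 2 * (1 - vp) ^ 2 := by positivity
  simp only [Btilde, Asimple, Bsimple, if_pos h1.le, if_neg (not_le.2 h2)]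
  linarith

lemma Gtilde_right (ω vp vm : ℝ) : Gtilde ω vp vm vm = 0 := by
  simp [Gtilde, K0tilde]

lemma Gtilde_left (ω : ℝ) {vp vm : ℝ} (h : vp < vm) : Gtilde ω vp vm vp = 0 := by
  have h' : vm - vp ≠ 0 := (sub_pos.2 h).ne'
  simp only [Gtilde, K0tilde, ctilde]
  field_simp
  ring

lemma abs_Gtilde_sub_le {ω vp vm : ℝ} (hω : 0 < ω) (h0 : 0 < vp) (h1 : vp < 1) (h2 : 1 < vm)
    {x y : ℝ} (hx : 0 ≤ x) (hy : 0 ≤ y) :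
    |Gtilde ω vp vm y - Gtilde ω vp vm x| ≤ (ctilde ω vp vm + 1 + ω) * |y - x| := by
  refine Convex.norm_image_sub_le_of_norm_hasDerivWithin_le
    (fun z _ => (hasDerivAt_Gtilde ω vp vm z).hasDerivWithinAt) (fun z hz => ?_)
    (convex_Ici 0) hx hy
  have hc := ctilde_pos hω h1 h2
  have hm : 1 ≤ max 1 z := le_max_left _ _
  have ha : 1 / (2 * max 1 z ^ 2) ≤ 1 := by
    rw [div_le_one (by positivity)]
    nlinarith
  have ha' : 0 ≤ 1 / (2 * max 1 z ^ 2) := by positivity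
  have hb : ω * max 0 (1 - z) ≤ ω := by
    have : max 0 (1 - z) ≤ 1 := max_le zero_le_one (by linarith [Set.mem_Ici.1 hz])
    nlinarith
  have hb' : 0 ≤ ω * max 0 (1 - z) := mul_nonneg hω.le (le_max_left _ _)
  rw [Real.norm_eq_abs, abs_le]
  constructor <;> linarith

/-- A function whose derivative dominates `1 / (L (x - a))` is unbounded below near `a`. -/
lemma exists_le_of_inv_le_deriv {a b L : ℝ} (hab : a < b) (hL : 0 < L) {Φ φ : ℝ → ℝ}
    (hΦ : ∀ x ∈ Set.Ioo a b, HasDerivAt Φ (φ x) x)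
    (hφ : ∀ x ∈ Set.Ioo a b, (L * (x - a))⁻¹ ≤ φ x) (ξ : ℝ) :
    ∃ x ∈ Set.Ioo a b, Φ x ≤ ξ := by
  have hd : ∀ x ∈ Set.Ioo a b,
      HasDerivAt (fun x => Φ x - Real.log (x - a) / L) (φ x - (L * (x - a))⁻¹) x := by
    intro x hx
    have hxa : x - a ≠ 0 := (sub_pos.2 hx.1).ne'
    refine ((hΦ x hx).sub
      ((((hasDerivAt_id x).sub_const a).log hxa).div_const L)).congr_deriv ?_
    simp only [id]
    field_simp
  have hmono : MonotoneOn (fun x => Φ x - Real.log (x - a) / L) (Set.Ioo a b) := by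
    refine monotoneOn_of_deriv_nonneg (convex_Ioo a b)
      (fun x hx => (hd x hx).continuousAt.continuousWithinAt)
      (fun x hx => (hd x (interior_subset hx)).differentiableAt.differentiableWithinAt)
      (fun x hx => ?_)
    rw [(hd x (interior_subset hx)).deriv]
    exact sub_nonneg.2 (hφ x (interior_subset hx))
  set m := (a + b) / 2 with hm
  set C := Φ m - Real.log (m - a) / L with hC
  set r := min (m - a) (Real.exp (L * (ξ - C))) with hr
  have hr0 : 0 < r := lt_min (by linarith) (Real.exp_pos _)
  have hrm : r ≤ m - a := min_le_left _ _
  have hmem : a + r ∈ Set.Ioo a b := ⟨by linarith, by linarith⟩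
  refine ⟨a + r, hmem, ?_⟩
  have h : Φ (a + r) - Real.log (a + r - a) / L ≤ C :=
    hmono hmem (show m ∈ Set.Ioo a b from ⟨by linarith, by linarith⟩) (by linarith)
  have hlog : Real.log r ≤ L * (ξ - C) := by
    rw [Real.log_le_iff_le_exp hr0]
    exact min_le_right _ _
  have hlog' : Real.log r / L ≤ ξ - C := by
    rw [div_le_iff₀ hL]
    linarith
  rw [add_sub_cancel_left] at h
  linarith

/-- The scalar equation `u' = f(u)`, with `f` positive on `(a, b)` and vanishing at most linearly
at the endpoints, has a solution connecting `a` to `b`. -/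
lemma exists_heteroclinic {a b L : ℝ} (hab : a < b) (hL : 0 < L) {f : ℝ → ℝ}
    (hfc : ContinuousOn f (Set.Ioo a b)) (hpos : ∀ x ∈ Set.Ioo a b, 0 < f x)
    (hfa : ∀ x ∈ Set.Ioo a b, f x ≤ L * (x - a))
    (hfb : ∀ x ∈ Set.Ioo a b, f x ≤ L * (b - x)) :
    ∃ u : ℝ → ℝ, StrictMono u ∧ (∀ ξ, u ξ ∈ Set.Ioo a b) ∧
      (∀ ξ, HasDerivAt u (f (u ξ)) ξ) ∧
      Filter.Tendsto u Filter.atBot (nhds a) ∧ Filter.Tendsto u Filter.atTop (nhds b) := by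
  have hmid : (a + b) / 2 ∈ Set.Ioo a b := ⟨by linarith, by linarith⟩
  have hinv : ContinuousOn (fun x => (f x)⁻¹) (Set.Ioo a b) :=
    hfc.inv₀ fun x hx => (hpos x hx).ne'
  set Φ : ℝ → ℝ := fun x => ∫ y in ((a + b) / 2)..x, (f y)⁻¹
  have hΦ : ∀ x ∈ Set.Ioo a b, HasDerivAt Φ (f x)⁻¹ x := by
    intro x hx
    refine intervalIntegral.integral_hasDerivAt_right
      (hinv.mono (Set.OrdConnected.uIcc_subset Set.ordConnected_Ioo hmid hx)).intervalIntegrable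
      ?_ (hinv.continuousAt (isOpen_Ioo.mem_nhds hx))
    exact hinv.stronglyMeasurableAtFilter isOpen_Ioo x hx
  have hΦc : ContinuousOn Φ (Set.Ioo a b) := fun x hx =>
    (hΦ x hx).continuousAt.continuousWithinAt
  have hΦm : StrictMonoOn Φ (Set.Ioo a b) := by
    refine strictMonoOn_of_deriv_pos (convex_Ioo a b) hΦc fun x hx => ?_
    rw [(hΦ x (interior_subset hx)).deriv]
    exact inv_pos.2 (hpos x (interior_subset hx))
  have hlow : ∀ ξ, ∃ x ∈ Set.Ioo a b, Φ x ≤ ξ :=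
    exists_le_of_inv_le_deriv hab hL hΦ fun x hx => inv_anti₀ (hpos x hx) (hfa x hx)
  have hhigh : ∀ ξ, ∃ x ∈ Set.Ioo a b, ξ ≤ Φ x := by
    intro ξ
    have hneg : ∀ x ∈ Set.Ioo (-b) (-a), -x ∈ Set.Ioo a b := fun x hx =>
      ⟨by linarith [hx.2], by linarith [hx.1]⟩
    obtain ⟨x, hx, hxξ⟩ := exists_le_of_inv_le_deriv (a := -b) (b := -a) (L := L)
      (Φ := fun x => -Φ (-x)) (φ := fun x => (f (-x))⁻¹) (by linarith) hL
      (fun x hx => by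
        have h := ((hΦ (-x) (hneg x hx)).comp x (hasDerivAt_neg x)).neg
        rw [mul_neg_one, neg_neg] at h
        exact h)
      (fun x hx => inv_anti₀ (hpos _ (hneg x hx)) (by
        have h := hfb _ (hneg x hx)
        rw [show x - -b = b - -x by ring]
        exact h)) (-ξ)
    exact ⟨-x, hneg x hx, by linarith⟩
  have hsurj : ∀ ξ, ∃ x ∈ Set.Ioo a b, Φ x = ξ := by
    intro ξ
    obtain ⟨p, hp, hpξ⟩ := hlow ξ
    obtain ⟨q, hq, hqξ⟩ := hhigh ξ
    exact (isPreconnected_Ioo.intermediate_value hp hq hΦc) ⟨hpξ, hqξ⟩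
  choose u hu huΦ using hsurj
  have hmono : StrictMono u := by
    intro ξ η h
    rwa [← hΦm.lt_iff_lt (hu ξ) (hu η), huΦ, huΦ]
  have hrange : Set.range u = Set.Ioo a b := by
    refine Set.Subset.antisymm (Set.range_subset_iff.2 hu) fun x hx => ⟨Φ x, ?_⟩
    exact hΦm.injOn (hu _) hx (huΦ _)
  have hcont : ∀ ξ, ContinuousAt u ξ := fun ξ =>
    (hmono.strictMonoOn Set.univ).continuousAt_of_image_mem_nhds Filter.univ_mem (by
      rw [Set.image_univ, hrange]
      exact isOpen_Ioo.mem_nhds (hu ξ))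
  refine ⟨u, hmono, hu, fun ξ => ?_, ?_, ?_⟩
  · have h := HasDerivAt.of_local_left_inverse (hcont ξ) (hΦ _ (hu ξ))
      (inv_ne_zero (hpos _ (hu ξ)).ne') (Filter.Eventually.of_forall huΦ)
    rwa [inv_inv] at h
  · exact tendsto_atBot_isGLB hmono.monotone (hrange ▸ isGLB_Ioo hab)
  · exact tendsto_atTop_isLUB hmono.monotone (hrange ▸ isLUB_Ioo hab)

/-- Let `ω > 0` and `0 < ṽ⁺ < 1 < ṽ⁻`.  Assume `G̃ < 0` on `(ṽ⁺, ṽ⁻)`,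
`G̃′(ṽ⁺) < 0` and `G̃′(ṽ⁻) > 0`.  Then there is a `C¹`, strictly decreasing
`ṽ : ℝ → (0,∞)` with `ṽ⁺ < ṽ < ṽ⁻`, limits `ṽ⁻` at `-∞` and `ṽ⁺` at `+∞`, and
`(A(ṽ(ξ)))' = K₀ + c̃ ṽ(ξ) - B̃(ṽ(ξ))`; hence `φ̃(x,t) := ṽ(x + c̃(T-t))` is a
traveling wave solution with positive wave speed `c̃` of
`∂ₜφ̃ + ∂ₓₓ A(φ̃) + ∂ₓ B̃(φ̃) = 0`. -/
theorem stmt_9 (ω T vp vm : ℝ) (hω : 0 < ω) (h0 : 0 < vp) (h1 : vp < 1) (h2 : 1 < vm)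
    (hGneg : ∀ v : ℝ, vp < v → v < vm → Gtilde ω vp vm v < 0)
    (hGp : deriv (Gtilde ω vp vm) vp < 0)
    (hGm : 0 < deriv (Gtilde ω vp vm) vm) :
    0 < ctilde ω vp vm ∧
    ∃ v : ℝ → ℝ, ContDiff ℝ 1 v ∧ StrictAnti v ∧ (∀ ξ, 0 < v ξ) ∧
      (∀ ξ, vp < v ξ ∧ v ξ < vm) ∧
      Filter.Tendsto v Filter.atBot (nhds vm) ∧
      Filter.Tendsto v Filter.atTop (nhds vp) ∧
      (∀ ξ, deriv (fun ξ' => Asimple (v ξ')) ξ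
        = K0tilde ω vp vm + ctilde ω vp vm * v ξ - Btilde ω (v ξ)) ∧
      (∀ x t : ℝ,
        deriv (fun s => v (x + ctilde ω vp vm * (T - s))) t
          + deriv (deriv (fun y => Asimple (v (y + ctilde ω vp vm * (T - t))))) x
          + deriv (fun y => Btilde ω (v (y + ctilde ω vp vm * (T - t)))) x = 0) := by
  have hc := ctilde_pos hω h1 h2
  refine ⟨hc, ?_⟩
  set c := ctilde ω vp vm with hcdef
  set f : ℝ → ℝ := fun x => -Gtilde ω vp vm x * (2 * max 1 x ^ 2) with hf
  have hGc : Continuous (Gtilde ω vp vm) :=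
    continuous_iff_continuousAt.2 fun x => (hasDerivAt_Gtilde ω vp vm x).continuousAt
  have hfc : Continuous f := by fun_prop
  have hbound : ∀ x ∈ Set.Ioo vp vm, ∀ z, 0 ≤ z → Gtilde ω vp vm z = 0 →
      f x ≤ (c + 1 + ω) * (2 * vm ^ 2) * |x - z| := by
    intro x hx z hz hGz
    have h := abs_Gtilde_sub_le hω h0 h1 h2 hz (h0.trans hx.1).le
    rw [hGz, sub_zero] at h
    have hmax : max 1 x ≤ vm := max_le h2.le hx.2.le
    calc f x ≤ (c + 1 + ω) * |x - z| * (2 * vm ^ 2) := by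
          refine mul_le_mul ((neg_le_abs _).trans h) ?_ (by positivity) (by positivity)
          gcongr
      _ = _ := by ring
  obtain ⟨u, humono, hu, hud, hubot, hutop⟩ := exists_heteroclinic (f := f)
    (L := (c + 1 + ω) * (2 * vm ^ 2)) (h1.trans h2) (by positivity) hfc.continuousOn
    (fun x hx => mul_pos (neg_pos.2 (hGneg x hx.1 hx.2)) (by positivity))
    (fun x hx => by
      have h := hbound x hx vp h0.le (Gtilde_left ω (h1.trans h2))
      rwa [abs_of_pos (sub_pos.2 hx.1)] at h)
    (fun x hx => by
      have h := hbound x hx vm (by linarith) (Gtilde_right ω vp vm)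
      rwa [abs_sub_comm, abs_of_pos (sub_pos.2 hx.2)] at h)
  set v : ℝ → ℝ := fun ξ => u (-ξ) with hv
  have hvd : ∀ ξ, HasDerivAt v (-f (v ξ)) ξ := fun ξ => by
    exact ((hud (-ξ)).comp ξ (hasDerivAt_neg ξ)).congr_deriv (mul_neg_one _)
  have hvc : Continuous v := continuous_iff_continuousAt.2 fun ξ => (hvd ξ).continuousAt
  have hAv : ∀ ξ, HasDerivAt (fun ξ' => Asimple (v ξ')) (Gtilde ω vp vm (v ξ)) ξ := fun ξ => by
    refine ((hasDerivAt_Asimple (v ξ)).comp ξ (hvd ξ)).congr_deriv ?_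
    have : (0 : ℝ) < max 1 (v ξ) := lt_max_of_lt_left one_pos
    simp only [hf]
    field_simp
  refine ⟨v, ?_, fun ξ η h => humono (neg_lt_neg h), fun ξ => h0.trans (hu _).1,
    fun ξ => hu _, hutop.comp Filter.tendsto_neg_atBot_atTop,
    hubot.comp Filter.tendsto_neg_atTop_atBot, fun ξ => (hAv ξ).deriv, fun x t => ?_⟩
  · refine contDiff_one_iff_deriv.2 ⟨fun ξ => (hvd ξ).differentiableAt, ?_⟩
    rw [show deriv v = fun ξ => -f (v ξ) from funext fun ξ => (hvd ξ).deriv]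
    fun_prop
  · set s := c * (T - t) with hs
    have hshift : ∀ y, HasDerivAt (fun y => v (y + s)) (-f (v (y + s))) y := fun y =>
      (hvd (y + s)).comp_add_const y s
    have htime : HasDerivAt (fun τ => v (x + c * (T - τ))) (-f (v (x + s)) * -c) t := by
      refine (hvd (x + s)).comp t (h := fun τ => x + c * (T - τ)) ?_
      simpa using (((hasDerivAt_id t).const_sub T).const_mul c).const_add x
    have hA : deriv (fun y => Asimple (v (y + s))) = fun y => Gtilde ω vp vm (v (y + s)) :=
      funext fun y => ((hAv (y + s)).comp_add_const y s).deriv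
    have hG := (hasDerivAt_Gtilde ω vp vm (v (x + s))).comp x (hshift x)
    have hB := (hasDerivAt_Btilde ω (v (x + s))).comp x (hshift x)
    rw [htime.deriv, hA]
    erw [hG.deriv, hB.deriv]
    ring
end
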